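/- Let (A_i)_{i∈ℕ} be a partition of ℕ such that for every n there exist at least n indices i with |A_i| ≥ n, and let Ω̃ be the associated chunked Kalton–Peck map. Then there do NOT exist a constant K and a homogeneous support-preserving map H : c00 → ℓ₂ such that ‖H(x+y) − H(x) − H(y) − Ω̃(x+y)‖₂ ≤ K‖x‖₂ for all x, y ∈ c00 with disjoint supports and ‖x‖₂ = ‖y‖₂. -/

import Mathlib

/-- `x : ℕ → ℝ` is finitely supported (i.e. belongs to `c00`). -/
def FinSupp (x : ℕ → ℝ) : Prop := (Function.support x).Finite

/-- The `ℓ₂` norm of a sequence, `‖x‖₂ = (∑ₙ |x n|²)^{1/2}`. -/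
noncomputable def l2Norm (x : ℕ → ℝ) : ℝ := Real.sqrt (∑' n, (x n) ^ 2)

/-- A partition `(A_i)_{i∈ℕ}` of `ℕ` is encoded by the function `π : ℕ → ℕ` sending each
`n ∈ ℕ` to the index of the member of the partition containing it, so `A_i = π⁻¹(i)`.
`chunk π i x` is the corresponding chunk `x_i = x·1_{A_i}` of a sequence `x`. -/
def chunk (π : ℕ → ℕ) (i : ℕ) (x : ℕ → ℝ) : ℕ → ℝ :=
  fun m => if π m = i then x m else 0

/-- The chunked Kalton–Peck map `Ω̃ : c00 → c00` associated to the partition encoded by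
`π`: `Ω̃(x) = Σ_i x_i·log(‖x‖₂/‖x_i‖₂)`, the sum over those `i` with `x_i ≠ 0` (written
pointwise: its value at `n` is `x n · log(‖x‖₂/‖x_{π n}‖₂)` when `x n ≠ 0`, else `0`). -/
noncomputable def KPchunk2 (π : ℕ → ℕ) (x : ℕ → ℝ) : ℕ → ℝ :=
  fun n => if x n = 0 then 0
    else x n * Real.log (l2Norm x / l2Norm (chunk π (π n) x))

/-- The partition encoded by `π` has, for every `n`, at least `n` members of cardinality
at least `n`. -/
def ManyLargeChunks (π : ℕ → ℕ) : Prop :=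
  ∀ n : ℕ, ∃ T : Finset ℕ, n ≤ T.card ∧
    ∀ i ∈ T, ∃ F : Finset ℕ, n ≤ F.card ∧ ∀ m ∈ F, π m = i

open Finset

/-- The indicator sequence `1_S` of a finite set `S ⊆ ℕ`. -/
def indicatorSeq (S : Finset ℕ) : ℕ → ℝ := fun n => if n ∈ S then 1 else 0

/-- `S` meets exactly `2 ^ a` members of the partition `π`, each of them in `2 ^ b` points. -/
def IsGrid (π : ℕ → ℕ) (S : Finset ℕ) (a b : ℕ) : Prop :=
  ∃ (T : Finset ℕ) (F : ℕ → Finset ℕ), #T = 2 ^ a ∧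
    (∀ i ∈ T, #(F i) = 2 ^ b ∧ ∀ m ∈ F i, π m = i) ∧ S = T.biUnion F

lemma finSupp_indicatorSeq (S : Finset ℕ) : FinSupp (indicatorSeq S) := by
  refine S.finite_toSet.subset fun n hn => ?_
  by_contra h
  exact hn (if_neg h)

lemma indicatorSeq_union {S U : Finset ℕ} (h : Disjoint S U) :
    indicatorSeq (S ∪ U) = indicatorSeq S + indicatorSeq U := by
  ext n
  have : n ∈ S → n ∉ U := fun hn => Finset.disjoint_left.1 h hn
  by_cases h1 : n ∈ S <;> by_cases h2 : n ∈ U <;> simp_all [indicatorSeq]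

lemma l2Norm_eq_sqrt_sum {x : ℕ → ℝ} {S : Finset ℕ} (h : ∀ n ∉ S, x n = 0) :
    l2Norm x = √(∑ n ∈ S, x n ^ 2) := by
  rw [l2Norm, tsum_eq_sum (s := S)]
  intro n hn
  simp [h n hn]

lemma l2Norm_indicatorSeq (S : Finset ℕ) : l2Norm (indicatorSeq S) = √(#S : ℝ) := by
  rw [l2Norm_eq_sqrt_sum (x := indicatorSeq S) (S := S) fun n hn => if_neg hn]
  congr 1
  rw [Finset.sum_congr rfl (g := fun _ => (1 : ℝ)) fun n hn => by simp [indicatorSeq, hn]]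
  simp

lemma chunk_indicatorSeq (π : ℕ → ℕ) (i : ℕ) (S : Finset ℕ) :
    chunk π i (indicatorSeq S) = indicatorSeq {m ∈ S | π m = i} := by
  ext m
  by_cases h1 : m ∈ S <;> by_cases h2 : π m = i <;> simp [chunk, indicatorSeq, h1, h2]

lemma abs_sum_le_of_l2Norm_le {x : ℕ → ℝ} {S : Finset ℕ} {K : ℝ} {s : ℕ}
    (h : ∀ n ∉ S, x n = 0) (hS : #S = 2 * s) (hx : l2Norm x ≤ K * √(s : ℝ)) :
    |∑ n ∈ S, x n| ≤ |K| * #S := by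
  have hcs := sq_sum_le_card_mul_sum_sq (s := S) (f := x)
  have hsum : 0 ≤ ∑ n ∈ S, x n ^ 2 := Finset.sum_nonneg fun _ _ => sq_nonneg _
  have hsq : ∑ n ∈ S, x n ^ 2 ≤ K ^ 2 * s := by
    rw [l2Norm_eq_sqrt_sum h] at hx
    have := pow_le_pow_left₀ (Real.sqrt_nonneg _) hx 2
    rwa [Real.sq_sqrt hsum, mul_pow, Real.sq_sqrt (Nat.cast_nonneg s)] at this
  have hS' : (#S : ℝ) = 2 * s := by exact_mod_cast hS
  refine abs_le_of_sq_le_sq ?_ (by positivity)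
  rw [mul_pow, sq_abs]
  rw [hS'] at hcs ⊢
  have := mul_le_mul_of_nonneg_left hsq (by positivity : (0 : ℝ) ≤ 2 * s)
  nlinarith [mul_nonneg (sq_nonneg K) (sq_nonneg (s : ℝ))]

namespace IsGrid

variable {π : ℕ → ℕ} {S : Finset ℕ} {a b : ℕ}

lemma card_biUnion {T : Finset ℕ} {F : ℕ → Finset ℕ}
    (hF : ∀ i ∈ T, #(F i) = 2 ^ b ∧ ∀ m ∈ F i, π m = i) :
    #(T.biUnion F) = #T * 2 ^ b := by
  rw [Finset.card_biUnion, Finset.sum_const_nat fun i hi => (hF i hi).1]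
  intro i hi j hj hij
  refine Finset.disjoint_left.2 fun m hm hm' => hij ?_
  rw [← (hF i hi).2 m hm, (hF j hj).2 m hm']

lemma card_eq (h : IsGrid π S a b) : #S = 2 ^ (a + b) := by
  obtain ⟨T, F, hT, hF, rfl⟩ := h
  rw [card_biUnion hF, hT, pow_add]

lemma card_filter (h : IsGrid π S a b) {n : ℕ} (hn : n ∈ S) : #{m ∈ S | π m = π n} = 2 ^ b := by
  obtain ⟨T, F, hT, hF, rfl⟩ := h
  obtain ⟨i, hi, hni⟩ := Finset.mem_biUnion.1 hn
  rw [← (hF i hi).1, (hF i hi).2 n hni]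
  congr 1
  ext m
  simp only [Finset.mem_filter, Finset.mem_biUnion]
  constructor
  · rintro ⟨⟨j, hj, hmj⟩, rfl⟩
    rwa [(hF j hj).2 m hmj]
  · exact fun hm => ⟨⟨i, hi, hm⟩, (hF i hi).2 m hm⟩

lemma exists_split_chunks (h : IsGrid π S (a + 1) b) :
    ∃ U V, Disjoint U V ∧ U ∪ V = S ∧ IsGrid π U a b ∧ IsGrid π V a b := by
  obtain ⟨T, F, hT, hF, rfl⟩ := h
  obtain ⟨T₁, hT₁, hc⟩ := Finset.exists_subset_card_eq (s := T) (n := 2 ^ a)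
    (by rw [hT]; gcongr <;> simp)
  refine ⟨T₁.biUnion F, (T \ T₁).biUnion F, ?_, ?_,
    ⟨T₁, F, hc, fun i hi => hF i (hT₁ hi), rfl⟩,
    ⟨T \ T₁, F, ?_, fun i hi => hF i (Finset.sdiff_subset hi), rfl⟩⟩
  · refine Finset.disjoint_left.2 fun m hm hm' => ?_
    obtain ⟨i, hi, hmi⟩ := Finset.mem_biUnion.1 hm
    obtain ⟨j, hj, hmj⟩ := Finset.mem_biUnion.1 hm'
    have hij : i = j := by
      rw [← (hF i (hT₁ hi)).2 m hmi, (hF j (Finset.sdiff_subset hj)).2 m hmj]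
    exact (Finset.mem_sdiff.1 hj).2 (hij ▸ hi)
  · rw [← Finset.union_biUnion, Finset.union_sdiff_of_subset hT₁]
  · rw [Finset.card_sdiff_of_subset hT₁, hT, hc, pow_succ]; omega

lemma exists_split_points (h : IsGrid π S a (b + 1)) :
    ∃ U V, Disjoint U V ∧ U ∪ V = S ∧ IsGrid π U a b ∧ IsGrid π V a b := by
  obtain ⟨T, F, hT, hF, rfl⟩ := h
  have hex : ∀ i, ∃ G ⊆ F i, i ∈ T → #G = 2 ^ b := by
    intro i
    by_cases hi : i ∈ T
    · obtain ⟨G, hG, hc⟩ := Finset.exists_subset_card_eq (s := F i) (n := 2 ^ b)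
        (by rw [(hF i hi).1]; gcongr <;> simp)
      exact ⟨G, hG, fun _ => hc⟩
    · exact ⟨∅, Finset.empty_subset _, fun h => absurd h hi⟩
  choose G hG hc using hex
  refine ⟨T.biUnion G, T.biUnion fun i => F i \ G i, ?_, ?_,
    ⟨T, G, hT, fun i hi => ⟨hc i hi, fun m hm => (hF i hi).2 m (hG i hm)⟩, rfl⟩,
    ⟨T, _, hT, fun i hi => ⟨?_, fun m hm => (hF i hi).2 m (Finset.sdiff_subset hm)⟩, rfl⟩⟩
  · refine Finset.disjoint_left.2 fun m hm hm' => ?_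
    obtain ⟨i, hi, hmi⟩ := Finset.mem_biUnion.1 hm
    obtain ⟨j, hj, hmj⟩ := Finset.mem_biUnion.1 hm'
    have hij : i = j := by
      rw [← (hF i hi).2 m (hG i hmi), (hF j hj).2 m (Finset.sdiff_subset hmj)]
    exact (Finset.mem_sdiff.1 hmj).2 (hij ▸ hmi)
  · ext m
    simp only [Finset.mem_union, Finset.mem_biUnion, Finset.mem_sdiff]
    constructor
    · rintro (⟨i, hi, hm⟩ | ⟨i, hi, hm⟩)
      exacts [⟨i, hi, hG i hm⟩, ⟨i, hi, hm.1⟩]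
    · rintro ⟨i, hi, hm⟩
      by_cases h : m ∈ G i
      exacts [Or.inl ⟨i, hi, h⟩, Or.inr ⟨i, hi, hm, h⟩]
  · rw [Finset.card_sdiff_of_subset (hG i), (hF i hi).1, hc i hi, pow_succ]; omega

lemma sum_KPchunk2 (h : IsGrid π S a b) :
    ∑ n ∈ S, KPchunk2 π (indicatorSeq S) n = 2 ^ (a + b) * (a * (Real.log 2 / 2)) := by
  have hval : ∀ n ∈ S, KPchunk2 π (indicatorSeq S) n = a * (Real.log 2 / 2) := by
    intro n hn
    have h1 : indicatorSeq S n = 1 := if_pos hn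
    rw [KPchunk2, h1, if_neg one_ne_zero, one_mul, chunk_indicatorSeq, l2Norm_indicatorSeq,
      l2Norm_indicatorSeq, h.card_filter hn, h.card_eq, ← Real.sqrt_div (by positivity),
      Real.log_sqrt (by positivity)]
    push_cast
    rw [pow_add, mul_div_assoc, div_self (by positivity), mul_one, Real.log_pow]
    ring
  rw [Finset.sum_congr rfl hval, Finset.sum_const, h.card_eq]
  simp

end IsGrid

lemma ManyLargeChunks.exists_isGrid {π : ℕ → ℕ} (hπ : ManyLargeChunks π) (k : ℕ) :
    ∃ S, IsGrid π S k k := by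
  obtain ⟨T, hT, hF⟩ := hπ (2 ^ k)
  obtain ⟨T₁, hT₁, hc⟩ := Finset.exists_subset_card_eq hT
  have hex : ∀ i, ∃ G : Finset ℕ, i ∈ T₁ → #G = 2 ^ k ∧ ∀ m ∈ G, π m = i := by
    intro i
    by_cases hi : i ∈ T₁
    · obtain ⟨F, hFc, hFπ⟩ := hF i (hT₁ hi)
      obtain ⟨G, hG, hGc⟩ := Finset.exists_subset_card_eq hFc
      exact ⟨G, fun _ => ⟨hGc, fun m hm => hFπ m (hG hm)⟩⟩
    · exact ⟨∅, fun h => absurd h hi⟩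
  choose G hG using hex
  exact ⟨_, T₁, G, hc, hG, rfl⟩

/-- `g` satisfies, up to an error `C * #S` on grids `S`, the halving relation of a
witness for the chunked Kalton–Peck map with `L = log 2 / 2`. -/
def HalvingBound (π : ℕ → ℕ) (L C : ℝ) (g : Finset ℕ → ℝ) : Prop :=
  ∀ ⦃a b : ℕ⦄ ⦃U V : Finset ℕ⦄, IsGrid π (U ∪ V) a b → Disjoint U V → #U = #V →
    |g (U ∪ V) - g U - g V - 2 ^ (a + b) * (a * L)| ≤ C * 2 ^ (a + b)

namespace HalvingBound

variable {π : ℕ → ℕ} {L C : ℝ} {g : Finset ℕ → ℝ}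

lemma abs_sub_le_chunks_first (hg : HalvingBound π L C g) (h₀ : ∀ n, g {n} = 0) (a b : ℕ) :
    ∀ S, IsGrid π S a b →
      |g S - 2 ^ (a + b) * (L * (a * (a + 1) / 2))| ≤ C * (a + b) * 2 ^ (a + b) := by
  induction a with
  | zero =>
    induction b with
    | zero =>
      intro S hS
      obtain ⟨n, rfl⟩ := Finset.card_eq_one.1 hS.card_eq
      simp [h₀]
    | succ b ih =>
      intro S hS
      obtain ⟨U, V, hd, rfl, hU, hV⟩ := hS.exists_split_points
      have h1 := abs_le.1 (hg hS hd (by rw [hU.card_eq, hV.card_eq]))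
      have h2 := abs_le.1 (ih U hU)
      have h3 := abs_le.1 (ih V hV)
      simp only [zero_add, pow_succ] at h1 h2 h3 ⊢
      push_cast at h1 h2 h3 ⊢
      rw [abs_le]
      constructor <;> nlinarith
  | succ a ih =>
    intro S hS
    obtain ⟨U, V, hd, rfl, hU, hV⟩ := hS.exists_split_chunks
    have h1 := abs_le.1 (hg hS hd (by rw [hU.card_eq, hV.card_eq]))
    have h2 := abs_le.1 (ih U hU)
    have h3 := abs_le.1 (ih V hV)
    rw [show a + 1 + b = a + b + 1 by ring] at h1 ⊢
    simp only [pow_succ] at h1 h2 h3 ⊢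
    push_cast at h1 h2 h3 ⊢
    rw [abs_le]
    constructor <;> nlinarith

lemma abs_sub_le_points_first (hg : HalvingBound π L C g) (h₀ : ∀ n, g {n} = 0) (a b : ℕ) :
    ∀ S, IsGrid π S a b →
      |g S - 2 ^ (a + b) * (L * (a * b + a * (a + 1) / 2))| ≤ C * (a + b) * 2 ^ (a + b) := by
  induction b with
  | zero => simpa using hg.abs_sub_le_chunks_first h₀ a 0
  | succ b ih =>
    intro S hS
    obtain ⟨U, V, hd, rfl, hU, hV⟩ := hS.exists_split_points
    have h1 := abs_le.1 (hg hS hd (by rw [hU.card_eq, hV.card_eq]))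
    have h2 := abs_le.1 (ih U hU)
    have h3 := abs_le.1 (ih V hV)
    rw [show a + (b + 1) = a + b + 1 by ring] at h1 ⊢
    simp only [pow_succ] at h1 h2 h3 ⊢
    push_cast at h1 h2 h3 ⊢
    rw [abs_le]
    constructor <;> nlinarith

lemma mul_le (hg : HalvingBound π L C g) (h₀ : ∀ n, g {n} = 0) {k : ℕ} (hk : 0 < k)
    {S : Finset ℕ} (hS : IsGrid π S k k) : L * k ≤ 4 * C := by
  have h1 := abs_le.1 (hg.abs_sub_le_chunks_first h₀ k k S hS)
  have h2 := abs_le.1 (hg.abs_sub_le_points_first h₀ k k S hS)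
  have hpos : (0 : ℝ) < k * 2 ^ (k + k) := by positivity
  refine le_of_mul_le_mul_right ?_ hpos
  nlinarith

end HalvingBound

/-- Let `(A_i)` be a partition of `ℕ` such that for every `n` there are
at least `n` indices `i` with `|A_i| ≥ n`, and let `Ω̃` be the associated chunked
Kalton–Peck map. Then there are NO constant `K` and homogeneous support-preserving map
`H : c00 → ℓ₂` such that `‖H(x+y) − H(x) − H(y) − Ω̃(x+y)‖₂ ≤ K‖x‖₂` for all `x, y ∈ c00`
with disjoint supports and `‖x‖₂ = ‖y‖₂`. -/
theorem no_witness_for_chunked_KP (π : ℕ → ℕ) (hπ : ManyLargeChunks π) :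
    ¬ ∃ (K : ℝ) (H : (ℕ → ℝ) → (ℕ → ℝ)),
        (∀ x, FinSupp x → Summable (fun n => (H x n) ^ 2)) ∧
        (∀ (c : ℝ) (x : ℕ → ℝ), FinSupp x → H (c • x) = c • H x) ∧
        (∀ x : ℕ → ℝ, FinSupp x → ∀ n, x n = 0 → H x n = 0) ∧
        (∀ x y : ℕ → ℝ, FinSupp x → FinSupp y →
          (∀ n, x n = 0 ∨ y n = 0) → l2Norm x = l2Norm y →
          l2Norm (fun n => H (x + y) n - H x n - H y n - KPchunk2 π (x + y) n)
            ≤ K * l2Norm x) := by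
  rintro ⟨K, H, -, -, hsupp, hH⟩
  have hsupp' : ∀ S : Finset ℕ, ∀ n ∉ S, H (indicatorSeq S) n = 0 := fun S n hn =>
    hsupp _ (finSupp_indicatorSeq S) n (if_neg hn)
  let h : Finset ℕ → ℝ := fun S => ∑ n ∈ S, H (indicatorSeq S) n
  let g : Finset ℕ → ℝ := fun S => h S - ∑ n ∈ S, h {n}
  have h₀ : ∀ n, g {n} = 0 := fun n => by simp [g]
  have hg : HalvingBound π (Real.log 2 / 2) |K| g := by
    intro a b U V hS hd hc
    have hD := hH (indicatorSeq U) (indicatorSeq V) (finSupp_indicatorSeq U)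
      (finSupp_indicatorSeq V)
      (fun n => by
        by_cases hn : n ∈ U
        · exact Or.inr (if_neg (Finset.disjoint_left.1 hd hn))
        · exact Or.inl (if_neg hn))
      (by rw [l2Norm_indicatorSeq, l2Norm_indicatorSeq, hc])
    rw [← indicatorSeq_union hd, l2Norm_indicatorSeq] at hD
    have hle := abs_sum_le_of_l2Norm_le (S := U ∪ V) (fun n hn => by
      have hn' := hn
      rw [Finset.mem_union, not_or] at hn'
      have : indicatorSeq (U ∪ V) n = 0 := if_neg hn
      simp [hsupp' _ n hn, hsupp' _ n hn'.1, hsupp' _ n hn'.2, KPchunk2, this])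
      (by rw [Finset.card_union_of_disjoint hd, ← hc]; ring) hD
    have hU : ∑ n ∈ U ∪ V, H (indicatorSeq U) n = h U :=
      (Finset.sum_subset Finset.subset_union_left fun n _ hn => hsupp' U n hn).symm
    have hV : ∑ n ∈ U ∪ V, H (indicatorSeq V) n = h V :=
      (Finset.sum_subset Finset.subset_union_right fun n _ hn => hsupp' V n hn).symm
    rw [Finset.sum_sub_distrib, Finset.sum_sub_distrib, Finset.sum_sub_distrib, hU, hV,
      hS.sum_KPchunk2, hS.card_eq] at hle
    push_cast at hle
    convert hle using 2
    simp only [g, Finset.sum_union hd, h]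
    ring
  have hL : 0 < Real.log 2 / 2 := by have := Real.log_pos one_lt_two; positivity
  obtain ⟨k, hk⟩ := exists_nat_gt (4 * |K| / (Real.log 2 / 2))
  have hk₀ : 0 < k := by
    have : (0 : ℝ) < k := lt_of_le_of_lt (by positivity) hk
    exact_mod_cast this
  obtain ⟨S, hS⟩ := hπ.exists_isGrid k
  have := hg.mul_le h₀ hk₀ hS
  rw [div_lt_iff₀ hL] at hk
  linarith
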